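/- arXiv:1305.4568 — 2 statements merged into one kernel-verified Lean document; each statement's English description precedes it below -/
import Mathlib

section
/- (Theorem 3.1, Step 1, forward direction) Let Ĉ be the operator Ĉ f̂ = A f̂ + Σ_{j=1}^N A_j ⟨f̂⟩_{1…j} on L²_M, with A, A₁,…,A_N continuous matrix symbols as in the context. If λ ∈ ℂ and det(A(k₀) − λI) = 0 for some k₀ ∈ [-π,π]^N, then λ belongs to the spectrum of Ĉ. -/
open MeasureTheory

noncomputable section

/-- The box `[-π, π]^N`. -/
def box (N : ℕ) : Set (Fin N → ℝ) := Set.univ.pi fun _ => Set.Icc (-Real.pi) Real.pi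

/-- Lebesgue measure restricted to the box `[-π, π]^N`. -/
def boxMeasure (N : ℕ) : Measure (Fin N → ℝ) := MeasureTheory.volume.restrict (box N)

/-- `L²_M`: square-integrable `ℂ^M`-valued functions on `[-π, π]^N`. -/
abbrev L2M (N M : ℕ) : Type := MeasureTheory.Lp (EuclideanSpace ℂ (Fin M)) 2 (boxMeasure N)

/-- `ℓ²(ℤ^N, ℂ^M)`. -/
abbrev ell2 (N M : ℕ) : Type := lp (fun _ : Fin N → ℤ => EuclideanSpace ℂ (Fin M)) 2

/-- The values of the Bloch–Floquet transform:
`(F h)(k) = (2π)^{-N/2} Σ_{n ∈ ℤ^N} h(n) e^{i n·k}`. -/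
def blochFormula {N M : ℕ} (h : (Fin N → ℤ) → EuclideanSpace ℂ (Fin M)) (k : Fin N → ℝ) :
    EuclideanSpace ℂ (Fin M) :=
  ((2 * Real.pi) ^ ((N : ℝ) / 2))⁻¹ •
    ∑' n : Fin N → ℤ, Complex.exp (Complex.I * ∑ i, (n i : ℂ) * (k i : ℂ)) • h n
/-- The (unnormalized) partial integral over the first `j` variables:
`(pint j f)(k) = ∫_{[-π,π]^j} f(t₁,…,t_j,k_{j+1},…,k_N) dt₁⋯dt_j`. -/
def pint {N M : ℕ} (j : ℕ) (f : (Fin N → ℝ) → EuclideanSpace ℂ (Fin M))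
    (k : Fin N → ℝ) : EuclideanSpace ℂ (Fin M) :=
  ∫ t : Fin j → ℝ in (Set.univ.pi fun _ => Set.Icc (-Real.pi) Real.pi),
    f fun i => if h : (i : ℕ) < j then t ⟨(i : ℕ), h⟩ else k i

/-- The normalized partial average
`⟨f⟩_{1…j}(k) = (2π)^{-j/2} ∫_{[-π,π]^j} f(t₁,…,t_j,k_{j+1},…,k_N) dt₁⋯dt_j`. -/
def navg {N M : ℕ} (j : ℕ) (f : (Fin N → ℝ) → EuclideanSpace ℂ (Fin M))
    (k : Fin N → ℝ) : EuclideanSpace ℂ (Fin M) :=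
  ((2 * Real.pi) ^ ((j : ℝ) / 2))⁻¹ • pint j f k

/-- Replace the first `j` coordinates of `k` by `t`. -/
def replaceFirst {N j : ℕ} (t : Fin j → ℝ) (k : Fin N → ℝ) : Fin N → ℝ :=
  fun i => if h : (i : ℕ) < j then t ⟨(i : ℕ), h⟩ else k i

lemma measurable_replaceFirst (N j : ℕ) :
    Measurable fun z : (Fin N → ℝ) × (Fin j → ℝ) => replaceFirst z.2 z.1 := by
  refine measurable_pi_lambda _ fun i => ?_
  unfold replaceFirst
  by_cases h : (i : ℕ) < j
  · simp only [h, dite_true]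
    fun_prop
  · simp only [h, dite_false]
    fun_prop

lemma quasiMeasurePreserving_replaceFirst (ν : Measure ℝ) [IsFiniteMeasure ν] [NeZero ν]
    {N j : ℕ} (hj : j ≤ N) :
    Measure.QuasiMeasurePreserving
      (fun z : (Fin N → ℝ) × (Fin j → ℝ) => replaceFirst z.2 z.1)
      ((Measure.pi fun _ => ν).prod (Measure.pi fun _ => ν)) (Measure.pi fun _ => ν) := by
  obtain ⟨m, rfl⟩ := exists_add_of_le hj
  refine ⟨measurable_replaceFirst _ _, ?_⟩
  have hc0 : ν Set.univ ^ j ≠ 0 :=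
    pow_ne_zero _ (by simpa using NeZero.ne ν)
  have hct : ν Set.univ ^ j ≠ ⊤ := ENNReal.pow_ne_top (measure_ne_top _ _)
  have key : (Measure.pi fun _ : Fin (j + m) => ν) = (ν Set.univ ^ j)⁻¹ •
      Measure.map (fun z : (Fin (j + m) → ℝ) × (Fin j → ℝ) => replaceFirst z.2 z.1)
      ((Measure.pi fun _ => ν).prod (Measure.pi fun _ => ν)) := by
    refine Measure.pi_eq fun s hs => ?_
    have hpre : (fun z : (Fin (j + m) → ℝ) × (Fin j → ℝ) => replaceFirst z.2 z.1) ⁻¹'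
        (Set.univ.pi s) =
        (Set.univ.pi fun i : Fin (j + m) => if (i : ℕ) < j then Set.univ else s i) ×ˢ
          (Set.univ.pi fun i : Fin j => s (Fin.castAdd m i)) := by
      ext ⟨k, t⟩
      simp only [Set.mem_preimage, Set.mem_pi, Set.mem_univ, true_imp_iff, Set.mem_prod,
        replaceFirst]
      constructor
      · intro h
        refine ⟨fun i => ?_, fun i => by simpa using h (Fin.castAdd m i)⟩
        by_cases hi : (i : ℕ) < j
        · simp [hi]
        · simpa [hi] using h i
      · rintro ⟨h₁, h₂⟩ i
        by_cases hi : (i : ℕ) < j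
        · simpa [hi] using h₂ ⟨i, hi⟩
        · simpa [hi] using h₁ i
    rw [Measure.smul_apply, Measure.map_apply (measurable_replaceFirst _ _)
      (MeasurableSet.univ_pi hs), hpre, Measure.prod_prod, Measure.pi_pi, Measure.pi_pi,
      Fin.prod_univ_add, Fin.prod_univ_add]
    simp only [Fin.val_castAdd, Fin.is_lt, if_true, Finset.prod_const, Finset.card_univ,
      Fintype.card_fin, Fin.val_natAdd, Nat.not_lt.mpr (Nat.le_add_right _ _), if_false,
      smul_eq_mul]
    rw [mul_assoc, ← mul_assoc, ENNReal.inv_mul_cancel hc0 hct, one_mul, mul_comm]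
  refine Measure.AbsolutelyContinuous.mk fun s _ h => ?_
  rw [key] at h
  simpa [hct, ENNReal.inv_eq_zero] using h

lemma boxMeasure_eq_pi (N : ℕ) :
    boxMeasure N =
      Measure.pi fun _ => (volume : Measure ℝ).restrict (Set.Icc (-Real.pi) Real.pi) := by
  rw [boxMeasure, box, volume_pi, Measure.restrict_pi_pi]

lemma pint_congr_ae {N M j : ℕ} (hj : j ≤ N) {f g : (Fin N → ℝ) → EuclideanSpace ℂ (Fin M)}
    (hfg : f =ᵐ[boxMeasure N] g) : pint j f =ᵐ[boxMeasure N] pint j g := by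
  have : NeZero ((volume : Measure ℝ).restrict (Set.Icc (-Real.pi) Real.pi)) := by
    refine ⟨fun h => ?_⟩
    rw [Measure.restrict_eq_zero, Real.volume_Icc, ENNReal.ofReal_eq_zero] at h
    linarith [Real.pi_pos]
  rw [boxMeasure_eq_pi] at hfg ⊢
  filter_upwards [Measure.ae_ae_of_ae_prod
    ((quasiMeasurePreserving_replaceFirst _ hj).ae hfg)] with k hk
  unfold pint
  rw [volume_pi, Measure.restrict_pi_pi]
  exact integral_congr_ae hk

/-- The function `k ↦ (k_i - c_i) v` cut off to the sup-norm ball of radius `δ` around `c`. -/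
def oddBump {N M : ℕ} (c : Fin N → ℝ) (δ : ℝ) (i : Fin N) (v : EuclideanSpace ℂ (Fin M)) :
    (Fin N → ℝ) → EuclideanSpace ℂ (Fin M) :=
  (Metric.ball c δ).indicator fun k => (k i - c i) • v

lemma memLp_oddBump {N M : ℕ} (c : Fin N → ℝ) (δ : ℝ) (i : Fin N)
    (v : EuclideanSpace ℂ (Fin M)) : MemLp (oddBump c δ i v) 2 (boxMeasure N) := by
  have : IsFiniteMeasure (boxMeasure N) := by
    rw [boxMeasure_eq_pi]
    infer_instance
  have hm : AEStronglyMeasurable (oddBump c δ i v) (boxMeasure N) := by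
    refine AEStronglyMeasurable.indicator ?_ measurableSet_ball
    exact Continuous.aestronglyMeasurable (by fun_prop)
  refine MemLp.of_bound hm (|δ| * ‖v‖) (Filter.Eventually.of_forall fun k => ?_)
  by_cases hk : k ∈ Metric.ball c δ
  · rw [oddBump, Set.indicator_of_mem hk, norm_smul]
    gcongr
    exact (dist_eq_norm (k i) (c i) ▸ dist_le_pi_dist k c i).trans (hk.le.trans (le_abs_self δ))
  · rw [oddBump, Set.indicator_of_notMem hk, norm_zero]
    positivity

lemma pint_oddBump {N M j : ℕ} (c : Fin N → ℝ) (δ : ℝ) (i : Fin N) (hij : (i : ℕ) < j)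
    (hj : j ≤ N) (hball : Metric.ball c δ ⊆ box N) (v : EuclideanSpace ℂ (Fin M))
    (k : Fin N → ℝ) : pint j (oddBump c δ i v) k = 0 := by
  have hzero : ∀ t : Fin j → ℝ, t ∉ (Set.univ.pi fun _ => Set.Icc (-Real.pi) Real.pi) →
      oddBump c δ i v (replaceFirst t k) = 0 := by
    intro t ht
    refine Set.indicator_of_notMem (fun hmem => ht fun l _ => ?_) _
    simpa [replaceFirst] using hball hmem (Fin.castLE hj l) (Set.mem_univ _)
  change ∫ t in _, oddBump c δ i v (replaceFirst t k) = 0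
  rw [setIntegral_eq_integral_of_forall_compl_eq_zero hzero]
  set c' : Fin j → ℝ := fun l => c (Fin.castLE hj l) with hc'
  have hodd : ∀ t : Fin j → ℝ, oddBump c δ i v (replaceFirst (c' + c' - t) k) =
      -oddBump c δ i v (replaceFirst t k) := by
    intro t
    have hdist : ∀ l, dist (replaceFirst (c' + c' - t) k l) (c l) =
        dist (replaceFirst t k l) (c l) := by
      intro l
      by_cases hl : (l : ℕ) < j
      · simp only [replaceFirst, hl, dite_true, Pi.sub_apply, Pi.add_apply, hc', Real.dist_eq,
          Fin.castLE_mk, Fin.eta]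
        rw [abs_sub_comm]
        congr 1
        ring
      · simp [replaceFirst, hl]
    have hmem : replaceFirst (c' + c' - t) k ∈ Metric.ball c δ ↔
        replaceFirst t k ∈ Metric.ball c δ := by
      rw [Metric.mem_ball, Metric.mem_ball, dist_pi_def, dist_pi_def]
      simp only [nndist_dist, hdist]
    by_cases h : replaceFirst t k ∈ Metric.ball c δ
    · rw [oddBump, Set.indicator_of_mem h, Set.indicator_of_mem (hmem.2 h), ← neg_smul]
      congr 1
      simp only [replaceFirst, hij, dite_true, Pi.sub_apply, Pi.add_apply, hc',
        Fin.castLE_mk, Fin.eta]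
      ring
    · rw [oddBump, Set.indicator_of_notMem h, Set.indicator_of_notMem (hmem.not.2 h), neg_zero]
  have hrefl := integral_sub_left_eq_self
    (fun t => oddBump c δ i v (replaceFirst t k)) volume (c' + c')
  simp only [hodd, integral_neg] at hrefl
  rw [neg_eq_iff_add_eq_zero, ← two_smul ℝ] at hrefl
  exact (smul_eq_zero.1 hrefl).resolve_left two_ne_zero

lemma not_oddBump_ae_eq_zero {N M : ℕ} (c : Fin N → ℝ) {δ : ℝ} (hδ : 0 < δ) (i : Fin N)
    (hball : Metric.ball c δ ⊆ box N) {v : EuclideanSpace ℂ (Fin M)} (hv : v ≠ 0) :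
    ¬ oddBump c δ i v =ᵐ[boxMeasure N] 0 := by
  intro h
  set U : Set (Fin N → ℝ) := Metric.ball c δ ∩ {k | c i < k i} with hU
  have hUo : IsOpen U :=
    Metric.isOpen_ball.inter (isOpen_lt continuous_const (continuous_apply i))
  have hUne : U.Nonempty := by
    refine ⟨fun l => c l + δ / 2, ?_, by simp [hδ]⟩
    rw [Metric.mem_ball, dist_pi_lt_iff hδ]
    intro l
    rw [Real.dist_eq, add_sub_cancel_left, abs_of_pos (half_pos hδ)]
    exact half_lt_self hδ
  have hpos : boxMeasure N U ≠ 0 := by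
    rw [boxMeasure, Measure.restrict_eq_self _ (Set.inter_subset_left.trans hball)]
    exact (hUo.measure_pos _ hUne).ne'
  refine hpos (measure_mono_null (fun k hk => ?_) (ae_iff.mp h))
  simp only [Set.mem_ofPred_eq, oddBump, Set.indicator_of_mem hk.1, Pi.zero_apply]
  exact smul_ne_zero (sub_pos.2 hk.2).ne' hv

lemma exists_ball_subset_box_inter {N : ℕ} {k₀ : Fin N → ℝ} (hk₀ : k₀ ∈ box N)
    {V : Set (Fin N → ℝ)} (hV : IsOpen V) (hk₀V : k₀ ∈ V) :
    ∃ c : Fin N → ℝ, ∃ δ > 0, Metric.ball c δ ⊆ box N ∩ V := by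
  have hcl : k₀ ∈ closure (interior (box N)) := by
    rw [box, interior_pi_set Set.finite_univ, closure_pi_set]
    intro i _
    rw [interior_Icc, closure_Ioo (by linarith [Real.pi_pos])]
    exact hk₀ i (Set.mem_univ i)
  obtain ⟨c, hcV, hcb⟩ := mem_closure_iff_nhds.1 hcl V (hV.mem_nhds hk₀V)
  obtain ⟨δ, hδ, hsub⟩ := Metric.isOpen_iff.1 (isOpen_interior.inter hV) c ⟨hcb, hcV⟩
  exact ⟨c, δ, hδ, hsub.trans (Set.inter_subset_inter_left _ interior_subset)⟩

lemma mem_spectrum_of_approx_eigenvector {E : Type*} [NormedAddCommGroup E] [NormedSpace ℂ E]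
    (T : E →L[ℂ] E) (lam : ℂ)
    (h : ∀ ε > 0, ∃ f : E, f ≠ 0 ∧ ‖T f - lam • f‖ ≤ ε * ‖f‖) : lam ∈ spectrum ℂ T := by
  rw [spectrum.mem_iff]
  rintro ⟨u, hu⟩
  set B : E →L[ℂ] E := ↑u⁻¹ with hB
  obtain ⟨f, hf, hle⟩ := h (1 / (‖B‖ + 1)) (by positivity)
  have hBf : B (lam • f - T f) = f := by
    have : (B * (u : E →L[ℂ] E)) f = f := by simp [hB]
    rwa [hu] at this
  have hfpos : 0 < ‖f‖ := norm_pos_iff.2 hf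
  have h₁ : ‖f‖ ≤ ‖B‖ * (1 / (‖B‖ + 1) * ‖f‖) := by
    calc ‖f‖ = ‖B (lam • f - T f)‖ := by rw [hBf]
      _ ≤ ‖B‖ * ‖lam • f - T f‖ := B.le_opNorm _
      _ ≤ _ := by rw [norm_sub_rev]; gcongr
  have h₂ : ‖B‖ * (1 / (‖B‖ + 1) * ‖f‖) < ‖f‖ := by
    rw [← mul_assoc, mul_one_div]
    refine mul_lt_of_lt_one_left hfpos ?_
    rw [div_lt_one (by positivity)]
    exact lt_add_one _
  exact absurd h₁ (not_le.2 h₂)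

/-- Theorem 3.1, Step 1, forward direction: for the operator
`Ĉ f̂ = A f̂ + Σ_{j=1}^N A_j ⟨f̂⟩_{1…j}` on `L²_M` with continuous `2π`-periodic symbols
(`A_j` not depending on `k₁,…,k_j`), if `det(A(k₀) − λI) = 0` for some `k₀ ∈ [-π,π]^N`,
then `λ ∈ spec(Ĉ)`. -/
theorem det_zero_implies_in_spectrum (N M : ℕ) (hN : 0 < N) (hM : 0 < M)
    (A : (Fin N → ℝ) → Matrix (Fin M) (Fin M) ℂ)
    (AA : ℕ → (Fin N → ℝ) → Matrix (Fin M) (Fin M) ℂ)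
    (hAcont : Continuous A)
    (hAper : ∀ (k : Fin N → ℝ) (i : Fin N),
      A (Function.update k i (k i + 2 * Real.pi)) = A k)
    (hAAcont : ∀ j ∈ Finset.Icc 1 N, Continuous (AA j))
    (hAAper : ∀ j ∈ Finset.Icc 1 N, ∀ (k : Fin N → ℝ) (i : Fin N),
      AA j (Function.update k i (k i + 2 * Real.pi)) = AA j k)
    (hAAindep : ∀ j ∈ Finset.Icc 1 N, ∀ k k' : Fin N → ℝ,
      (∀ i : Fin N, j ≤ (i : ℕ) → k i = k' i) → AA j k = AA j k')
    (Chat : L2M N M →L[ℂ] L2M N M)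
    (hChat : ∀ f : L2M N M, ∀ᵐ k ∂(boxMeasure N), ∀ a : Fin M,
      (Chat f) k a = (∑ b : Fin M, A k a b * f k b) +
        ∑ j ∈ Finset.Icc 1 N, ∑ b : Fin M, AA j k a b * navg j (⇑f) k b)
    (lam : ℂ) (k₀ : Fin N → ℝ) (hk₀ : k₀ ∈ box N)
    (hdet : (A k₀ - lam • (1 : Matrix (Fin M) (Fin M) ℂ)).det = 0) :
    lam ∈ spectrum ℂ Chat := by
  obtain ⟨w, hw, hAw⟩ := Matrix.exists_mulVec_eq_zero_iff.2 hdet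
  set v : EuclideanSpace ℂ (Fin M) := WithLp.toLp 2 w with hvdef
  have hv : v ≠ 0 := by simpa [hvdef] using hw
  set R : (Fin N → ℝ) → EuclideanSpace ℂ (Fin M) := fun k =>
    WithLp.toLp 2 ((A k - lam • (1 : Matrix (Fin M) (Fin M) ℂ)).mulVec w) with hR
  have hRcont : Continuous R :=
    (PiLp.continuous_toLp 2 _).comp
      ((hAcont.sub continuous_const).matrix_mulVec continuous_const)
  refine mem_spectrum_of_approx_eigenvector Chat lam fun ε hε => ?_
  obtain ⟨c, δ, hδ, hsub⟩ := exists_ball_subset_box_inter hk₀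
    (V := {k | ‖R k‖ < ε * ‖v‖}) (isOpen_lt hRcont.norm continuous_const)
    (by
      have : 0 < ε * ‖v‖ := mul_pos hε (norm_pos_iff.2 hv)
      simpa [hR, hAw] using this)
  have hball := hsub.trans Set.inter_subset_left
  set g := oddBump c δ ⟨0, hN⟩ v with hg
  set f : L2M N M := (memLp_oddBump c δ ⟨0, hN⟩ v).toLp g with hf
  have hfg : f =ᵐ[boxMeasure N] g := MemLp.coeFn_toLp _
  have havg : ∀ᵐ k ∂(boxMeasure N), ∀ j ∈ Finset.Icc 1 N, navg j (⇑f) k = 0 := by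
    rw [Filter.eventually_all_finset]
    intro j hj
    rw [Finset.mem_Icc] at hj
    filter_upwards [pint_congr_ae hj.2 hfg] with k hk
    rw [navg, hk, pint_oddBump c δ _ hj.1 hj.2 hball, smul_zero]
  refine ⟨f, fun h => ?_, ?_⟩
  · refine not_oddBump_ae_eq_zero c hδ ⟨0, hN⟩ hball hv (hfg.symm.trans ?_)
    rw [h]
    exact Lp.coeFn_zero _ _ _
  · refine Lp.norm_le_mul_norm_of_ae_le_mul ?_
    filter_upwards [hChat f, havg, hfg, Lp.coeFn_sub (Chat f) (lam • f),
      Lp.coeFn_smul lam f] with k hC havgk hfk hsubk hsmulk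
    rw [hsubk, Pi.sub_apply, hsmulk, Pi.smul_apply]
    have hCk : Chat f k = WithLp.toLp 2 ((A k).mulVec (f k)) := by
      ext a
      rw [hC a, Finset.sum_eq_zero (s := Finset.Icc 1 N), add_zero]
      · rfl
      · intro j hj
        simp [havgk j hj]
    rw [hCk, hfk]
    by_cases hk : k ∈ Metric.ball c δ
    · have hgk : g k = (k ⟨0, hN⟩ - c ⟨0, hN⟩) • v := Set.indicator_of_mem hk _
      have hres : WithLp.toLp 2 ((A k).mulVec (g k)) - lam • g k =
          (k ⟨0, hN⟩ - c ⟨0, hN⟩) • R k := by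
        ext a
        simp [hgk, hR, hvdef, Matrix.sub_mulVec, Matrix.mulVec_smul, Matrix.smul_mulVec]
        ring
      rw [hres, hgk, norm_smul, norm_smul, mul_left_comm]
      gcongr
      exact (hsub hk).2.le
    · have hgk : g k = 0 := Set.indicator_of_notMem hk _
      simp [hgk]
end
end

section
/- (Dimension-reduction equivalence in the proof of Theorem 3.1) Let Ĉ be as in the context, λ ∈ ℂ, B₀ := A − λI, and suppose det B₀(k) ≠ 0 for every k ∈ [-π,π]^N. Set B₁ := I + ⟨B₀^{-1} A₁⟩₁, a continuous matrix function of (k₂,…,k_N), and define the bounded operator Ĉ₁ on L²_M([-π,π]^{N-1}) (square-integrable ℂ^M-valued functions of (k₂,…,k_N)) by Ĉ₁ ĝ = B₁ ĝ + Σ_{j=2}^N ⟨B₀^{-1} A_j⟩₁ ⟨ĝ⟩_{2…j}. Then Ĉ − λ is a bijection of L²_M if and only if Ĉ₁ is a bijection of L²_M([-π,π]^{N-1}); equivalently, 0 ∈ spec(Ĉ − λ) ⇔ 0 ∈ spec(Ĉ₁). -/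
open MeasureTheory

noncomputable section

/-- Lebesgue measure restricted to `[-π, π]`. -/
abbrev sideMeasure : Measure ℝ := volume.restrict (Set.Icc (-Real.pi) Real.pi)

lemma sideMeasure_univ : sideMeasure Set.univ = ENNReal.ofReal (2 * Real.pi) := by
  rw [Measure.restrict_apply_univ, Real.volume_Icc]
  congr 1
  ring

lemma boxMeasure_eq_pi_s12 (N : ℕ) : boxMeasure N = Measure.pi fun _ : Fin N => sideMeasure := by
  rw [boxMeasure, box, volume_pi, Measure.restrict_pi_pi]

instance isFiniteMeasure_boxMeasure (N : ℕ) : IsFiniteMeasure (boxMeasure N) := by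
  rw [boxMeasure_eq_pi_s12]
  infer_instance

lemma ae_mem_box (N : ℕ) : ∀ᵐ k ∂boxMeasure N, k ∈ box N :=
  ae_restrict_mem (MeasurableSet.univ_pi fun _ => measurableSet_Icc)

lemma measurePreserving_cons (n : ℕ) :
    MeasurePreserving (fun p : ℝ × (Fin n → ℝ) => (Fin.cons p.1 p.2 : Fin (n + 1) → ℝ))
      (sideMeasure.prod (boxMeasure n)) (boxMeasure (n + 1)) := by
  rw [boxMeasure_eq_pi_s12, boxMeasure_eq_pi_s12]
  have h := (measurePreserving_piFinSuccAbove (fun _ : Fin (n + 1) => sideMeasure) 0).symm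
  convert h using 2
  simp [MeasurableEquiv.piFinSuccAbove, Fin.insertNthEquiv]

lemma measurePreserving_head_tail (n : ℕ) :
    MeasurePreserving (fun k : Fin (n + 1) → ℝ => (k 0, Fin.tail k))
      (boxMeasure (n + 1)) (sideMeasure.prod (boxMeasure n)) := by
  have h := measurePreserving_piFinSuccAbove (fun _ : Fin (n + 1) => sideMeasure) 0
  rwa [← boxMeasure_eq_pi_s12, ← boxMeasure_eq_pi_s12] at h

lemma quasiMeasurePreserving_tail (n : ℕ) :
    Measure.QuasiMeasurePreserving (Fin.tail : (Fin (n + 1) → ℝ) → (Fin n → ℝ))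
      (boxMeasure (n + 1)) (boxMeasure n) :=
  Measure.quasiMeasurePreserving_snd.comp (measurePreserving_head_tail n).quasiMeasurePreserving

lemma ae_ae_cons {n : ℕ} {p : (Fin (n + 1) → ℝ) → Prop} (h : ∀ᵐ k ∂boxMeasure (n + 1), p k) :
    ∀ᵐ k ∂boxMeasure n, ∀ᵐ t ∂sideMeasure, p (Fin.cons t k) := by
  have h' := (measurePreserving_cons n).quasiMeasurePreserving.ae h
  exact Measure.ae_ae_of_ae_prod
    (Measure.measurePreserving_swap.quasiMeasurePreserving.ae (p := fun q => p (Fin.cons q.1 q.2)) h')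

/-- Replace the first `j` coordinates of `k` by those of `t`. -/
def replaceInit {N : ℕ} (j : ℕ) (k : Fin N → ℝ) (t : Fin j → ℝ) : Fin N → ℝ :=
  fun i => if h : (i : ℕ) < j then t ⟨(i : ℕ), h⟩ else k i

lemma measurable_replaceInit {N : ℕ} (j : ℕ) :
    Measurable fun p : (Fin N → ℝ) × (Fin j → ℝ) => replaceInit j p.1 p.2 := by
  refine measurable_pi_lambda _ fun i => ?_
  unfold replaceInit
  split_ifs <;> fun_prop

lemma replaceInit_succ_cons {n j : ℕ} (k : Fin (n + 1) → ℝ) (t : ℝ) (s : Fin j → ℝ) :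
    replaceInit (j + 1) k (Fin.cons t s) = Fin.cons t (replaceInit j (Fin.tail k) s) := by
  funext i
  refine Fin.cases ?_ (fun i => ?_) i
  · simp [replaceInit]
  · simp only [replaceInit, Fin.cons_succ, Fin.val_succ, add_lt_add_iff_right, Fin.tail]
    split_ifs with h
    · exact Fin.cons_succ (α := fun _ => ℝ) t s ⟨i, h⟩
    · rfl

lemma map_replaceInit (j m : ℕ) :
    ((boxMeasure (j + m)).prod (boxMeasure j)).map
        (fun p : (Fin (j + m) → ℝ) × (Fin j → ℝ) => replaceInit j p.1 p.2) =
      (sideMeasure Set.univ) ^ j • boxMeasure (j + m) := by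
  have h0 : sideMeasure Set.univ ≠ 0 := by
    rw [sideMeasure_univ]; simp [Real.pi_pos]
  have ht : sideMeasure Set.univ ≠ ⊤ := measure_ne_top _ _
  have key : boxMeasure (j + m) = ((sideMeasure Set.univ) ^ j)⁻¹ •
      ((boxMeasure (j + m)).prod (boxMeasure j)).map
        (fun p : (Fin (j + m) → ℝ) × (Fin j → ℝ) => replaceInit j p.1 p.2) := by
    conv_lhs => rw [boxMeasure_eq_pi_s12]
    refine Measure.pi_eq fun s hs => ?_
    rw [Measure.smul_apply, Measure.map_apply (measurable_replaceInit j)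
      (MeasurableSet.univ_pi hs)]
    have hpre : (fun p : (Fin (j + m) → ℝ) × (Fin j → ℝ) => replaceInit j p.1 p.2) ⁻¹'
        (Set.univ.pi s) =
        (Set.univ.pi fun i : Fin (j + m) => if (i : ℕ) < j then Set.univ else s i) ×ˢ
          (Set.univ.pi fun i : Fin j => s (Fin.castAdd m i)) := by
      ext ⟨k, t⟩
      simp only [Set.mem_preimage, Set.mem_univ_pi, Set.mem_prod, Fin.forall_fin_add]
      simp [replaceInit, and_comm]
    rw [hpre, Measure.prod_prod, boxMeasure_eq_pi_s12, boxMeasure_eq_pi_s12, Measure.pi_pi,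
      Measure.pi_pi, Fin.prod_univ_add, Fin.prod_univ_add]
    simp only [Fin.val_castAdd, Fin.is_lt, if_true, Fin.val_natAdd, Finset.prod_const,
      Finset.card_univ, Fintype.card_fin, add_lt_iff_neg_left, not_lt_zero, if_false, smul_eq_mul]
    rw [mul_assoc, ← mul_assoc, ENNReal.inv_mul_cancel (pow_ne_zero _ h0) (by finiteness), one_mul,
      mul_comm]
  conv_rhs => rw [key]
  rw [smul_smul, ENNReal.mul_inv_cancel (pow_ne_zero _ h0) (by finiteness), one_smul]

lemma ae_ae_replaceInit {N j : ℕ} (hj : j ≤ N) {p : (Fin N → ℝ) → Prop}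
    (h : ∀ᵐ k ∂boxMeasure N, p k) :
    ∀ᵐ k ∂boxMeasure N, ∀ᵐ t ∂boxMeasure j, p (replaceInit j k t) := by
  obtain ⟨m, rfl⟩ := Nat.exists_eq_add_of_le hj
  have hq : Measure.QuasiMeasurePreserving
      (fun p : (Fin (j + m) → ℝ) × (Fin j → ℝ) => replaceInit j p.1 p.2)
      ((boxMeasure (j + m)).prod (boxMeasure j)) (boxMeasure (j + m)) := by
    refine ⟨measurable_replaceInit j, ?_⟩
    rw [map_replaceInit]
    exact Measure.smul_absolutelyContinuous
  exact Measure.ae_ae_of_ae_prod (hq.ae h)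

lemma ae_integrable_replaceInit {N j : ℕ} (hj : j ≤ N) {E : Type*} [NormedAddCommGroup E]
    {f : (Fin N → ℝ) → E} (hf : Integrable f (boxMeasure N)) :
    ∀ᵐ k ∂boxMeasure N, Integrable (fun t => f (replaceInit j k t)) (boxMeasure j) := by
  obtain ⟨m, rfl⟩ := Nat.exists_eq_add_of_le hj
  have h := hf.smul_measure (c := (sideMeasure Set.univ) ^ j) (by finiteness)
  rw [← map_replaceInit] at h
  exact (h.comp_measurable (measurable_replaceInit j)).prod_right_ae

section

variable {N n M : ℕ}

lemma pint_eq (j : ℕ) (f : (Fin N → ℝ) → EuclideanSpace ℂ (Fin M)) (k : Fin N → ℝ) :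
    pint j f k = ∫ t, f (replaceInit j k t) ∂boxMeasure j := rfl

lemma navg_zero (f : (Fin N → ℝ) → EuclideanSpace ℂ (Fin M)) : navg 0 f = f := by
  funext k
  have h : ∀ t, replaceInit 0 k t = k := fun t => by funext i; simp [replaceInit]
  have hm : (boxMeasure 0).real Set.univ = 1 := by
    simp [boxMeasure_eq_pi_s12, Measure.real]
  simp [navg, pint_eq, h, hm]

lemma ae_navg_congr {j : ℕ} (hj : j ≤ N) {f g : (Fin N → ℝ) → EuclideanSpace ℂ (Fin M)}
    (h : f =ᵐ[boxMeasure N] g) : navg j f =ᵐ[boxMeasure N] navg j g := by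
  filter_upwards [ae_ae_replaceInit hj h] with k hk
  rw [navg, navg, pint_eq, pint_eq, integral_congr_ae hk]

/-- The normalized average over the first variable, as a function of the remaining ones. -/
def firstAvg (f : (Fin (n + 1) → ℝ) → EuclideanSpace ℂ (Fin M)) (k : Fin n → ℝ) :
    EuclideanSpace ℂ (Fin M) :=
  ((2 * Real.pi) ^ ((1 : ℝ) / 2))⁻¹ • ∫ t, f (Fin.cons t k) ∂sideMeasure

lemma ae_navg_succ {j : ℕ} (hj : j ≤ n) {f : (Fin (n + 1) → ℝ) → EuclideanSpace ℂ (Fin M)}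
    (hf : Integrable f (boxMeasure (n + 1))) :
    ∀ᵐ k ∂boxMeasure (n + 1), navg (j + 1) f k = navg j (firstAvg f) (Fin.tail k) := by
  filter_upwards [ae_integrable_replaceInit (Nat.succ_le_succ hj) hf] with k hk
  have hc := measurePreserving_cons j
  have hk' : Integrable (fun p : ℝ × (Fin j → ℝ) =>
      f (Fin.cons p.1 (replaceInit j (Fin.tail k) p.2))) (sideMeasure.prod (boxMeasure j)) := by
    simpa only [replaceInit_succ_cons, Function.comp_def, Nat.succ_eq_add_one] using
      hc.integrable_comp_of_integrable hk
  have hpint : pint (j + 1) f k =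
      ∫ s, ∫ t, f (Fin.cons t (replaceInit j (Fin.tail k) s)) ∂sideMeasure ∂boxMeasure j := by
    rw [← integral_prod_symm _ hk', pint_eq, ← hc.map_eq, integral_map hc.aemeasurable]
    · simp only [replaceInit_succ_cons]
    · rw [hc.map_eq]; exact hk.1
  have hc : ((2 * Real.pi) ^ (((j + 1 : ℕ) : ℝ) / 2))⁻¹ =
      ((2 * Real.pi) ^ ((j : ℝ) / 2))⁻¹ * ((2 * Real.pi) ^ ((1 : ℝ) / 2))⁻¹ := by
    rw [← mul_inv, ← Real.rpow_add Real.two_pi_pos]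
    congr 2
    push_cast
    ring
  rw [navg, hpint, hc, mul_smul, ← integral_smul]
  rfl

lemma exists_linearMap_Lp {α β E F : Type*} [MeasurableSpace α] [MeasurableSpace β]
    [NormedAddCommGroup E] [NormedSpace ℂ E] [NormedAddCommGroup F] [NormedSpace ℂ F]
    {μ : Measure α} {ν : Measure β} (Φ : (α → E) → β → F)
    (hmem : ∀ f, MemLp f 2 μ → MemLp (Φ f) 2 ν)
    (hcongr : ∀ f g, f =ᵐ[μ] g → Φ f =ᵐ[ν] Φ g)
    (hadd : ∀ f g, MemLp f 2 μ → MemLp g 2 μ → Φ (f + g) =ᵐ[ν] Φ f + Φ g)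
    (hsmul : ∀ (c : ℂ) f, MemLp f 2 μ → Φ (c • f) =ᵐ[ν] c • Φ f) :
    ∃ T : Lp E 2 μ →ₗ[ℂ] Lp F 2 ν, ∀ f, T f =ᵐ[ν] Φ f := by
  refine ⟨{ toFun := fun f => (hmem f (Lp.memLp f)).toLp (Φ f)
            map_add' := fun f g => ?_
            map_smul' := fun c f => ?_ }, fun f => MemLp.coeFn_toLp (hmem f (Lp.memLp f))⟩
  · rw [← MemLp.toLp_add]
    exact MemLp.toLp_congr _ _ ((hcongr _ _ (Lp.coeFn_add f g)).trans
      (hadd _ _ (Lp.memLp f) (Lp.memLp g)))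
  · rw [RingHom.id_apply, ← MemLp.toLp_const_smul]
    exact MemLp.toLp_congr _ _ ((hcongr _ _ (Lp.coeFn_smul c f)).trans (hsmul c _ (Lp.memLp f)))

lemma memLp_integral_left {α β E : Type*} [MeasurableSpace α] [MeasurableSpace β]
    [NormedAddCommGroup E] [NormedSpace ℝ E] {μ : Measure α} {ν : Measure β}
    [IsFiniteMeasure μ] [SFinite ν] {f : α × β → E} (hf : MemLp f 2 (μ.prod ν)) :
    MemLp (fun y => ∫ x, f (x, y) ∂μ) 2 ν := by
  have hswap : AEStronglyMeasurable (fun p : β × α => f (p.2, p.1)) (ν.prod μ) := hf.1.prod_swap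
  refine ⟨hswap.integral_prod_right', ?_⟩
  have hfin := (eLpNorm_lt_top_iff_lintegral_rpow_enorm_lt_top (by simp) (by simp)).1 hf.2
  rw [eLpNorm_lt_top_iff_lintegral_rpow_enorm_lt_top (by simp) (by simp)]
  have hm : AEMeasurable (fun p => ‖f p‖ₑ ^ (2 : ENNReal).toReal) (μ.prod ν) :=
    hf.1.enorm.pow_const _
  have hbound : ∀ᵐ y ∂ν, ‖∫ x, f (x, y) ∂μ‖ₑ ^ (2 : ENNReal).toReal ≤
      μ Set.univ * ∫⁻ x, ‖f (x, y)‖ₑ ^ (2 : ENNReal).toReal ∂μ := by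
    filter_upwards [hswap.prodMk_left] with y hy
    have h1 : ‖∫ x, f (x, y) ∂μ‖ₑ ≤ eLpNorm (fun x => f (x, y)) 1 μ := by
      rw [eLpNorm_one_eq_lintegral_enorm]
      exact enorm_integral_le_lintegral_enorm _
    have h2 := h1.trans (eLpNorm_le_eLpNorm_mul_rpow_measure_univ (p := 1) (q := 2)
      (by norm_num) hy)
    refine (ENNReal.rpow_le_rpow h2 (by simp)).trans (le_of_eq ?_)
    rw [ENNReal.mul_rpow_of_nonneg _ _ (by simp), ← ENNReal.rpow_mul,
      eLpNorm_eq_lintegral_rpow_enorm_toReal (by simp) (by simp), ← ENNReal.rpow_mul, mul_comm]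
    norm_num
  refine (lintegral_mono_ae hbound).trans_lt ?_
  rw [lintegral_const_mul' _ _ (measure_ne_top _ _), ← lintegral_prod_symm _ hm]
  exact ENNReal.mul_lt_top (measure_lt_top _ _) hfin

lemma exists_mulOp {α E : Type*} [MeasurableSpace α] [NormedAddCommGroup E] [NormedSpace ℂ E]
    {μ : Measure α} {L : α → E →L[ℂ] E} (hL : AEStronglyMeasurable L μ) {c : ℝ}
    (hc : ∀ᵐ x ∂μ, ‖L x‖ ≤ c) :
    ∃ T : Lp E 2 μ →ₗ[ℂ] Lp E 2 μ, ∀ f, T f =ᵐ[μ] fun x => L x (f x) := by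
  refine exists_linearMap_Lp (fun f x => L x (f x)) (fun f hf => ?_) (fun f g h => ?_)
    (fun f g _ _ => ?_) (fun r f _ => ?_)
  · refine hf.of_le_mul (c := c)
      (isBoundedBilinearMap_apply.continuous.comp_aestronglyMeasurable (hL.prodMk hf.1)) ?_
    filter_upwards [hc] with x hx
    exact (L x).le_of_opNorm_le hx _
  · filter_upwards [h] with x hx
    rw [hx]
  · exact .of_forall fun x => by simp
  · exact .of_forall fun x => by simp

/-- A matrix acting on `ℂ^M`, as a star algebra isomorphism onto the continuous operators. -/
abbrev matOp : Matrix (Fin M) (Fin M) ℂ ≃⋆ₐ[ℂ]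
    (EuclideanSpace ℂ (Fin M) →L[ℂ] EuclideanSpace ℂ (Fin M)) :=
  Matrix.toEuclideanCLM (n := Fin M) (𝕜 := ℂ)

lemma matOp_apply (B : Matrix (Fin M) (Fin M) ℂ) (v : EuclideanSpace ℂ (Fin M)) (a : Fin M) :
    matOp B v a = ∑ b, B a b * v b := rfl

lemma matOp_mul_apply (B C : Matrix (Fin M) (Fin M) ℂ) (v : EuclideanSpace ℂ (Fin M)) :
    matOp (B * C) v = matOp B (matOp C v) := by
  rw [map_mul]
  rfl

lemma continuous_matOp : Continuous (matOp (M := M)) :=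
  LinearMap.continuous_of_finiteDimensional (matOp (M := M)).toAlgEquiv.toLinearMap

lemma continuousOn_matrix_inv {α : Type*} [TopologicalSpace α]
    {B : α → Matrix (Fin M) (Fin M) ℂ} {s : Set α}
    (hB : Continuous B) (hdet : ∀ k ∈ s, (B k).det ≠ 0) : ContinuousOn (fun k => (B k)⁻¹) s := by
  simp only [Matrix.inv_def, Ring.inverse_eq_inv']
  exact (hB.matrix_det.continuousOn.inv₀ hdet).smul hB.matrix_adjugate.continuousOn

lemma integral_matOp_apply {G : ℝ → Matrix (Fin M) (Fin M) ℂ}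
    (hG : ContinuousOn G (Set.Icc (-Real.pi) Real.pi)) (v : EuclideanSpace ℂ (Fin M))
    (a : Fin M) :
    (∫ t, matOp (G t) v ∂sideMeasure) a = ∑ b, (∫ t, G t a b ∂sideMeasure) * v b := by
  have hint : Integrable (fun t => matOp (G t) v) sideMeasure :=
    ((continuous_matOp.comp_continuousOn hG).clm_apply continuousOn_const).integrableOn_Icc
  have hent : ∀ b, Integrable (fun t => G t a b) sideMeasure := fun b =>
    ((continuous_id.matrix_elem a b).comp_continuousOn hG).integrableOn_Icc
  have h : ∫ t, matOp (G t) v a ∂sideMeasure = (∫ t, matOp (G t) v ∂sideMeasure) a :=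
    (EuclideanSpace.proj (𝕜 := ℂ) a).integral_comp_comm hint
  simp only [← h, matOp_apply]
  rw [integral_finsetSum _ fun b _ => (hent b).mul_const _]
  simp only [integral_mul_const]

lemma exists_matrixMulOp {B : (Fin N → ℝ) → Matrix (Fin M) (Fin M) ℂ}
    (hB : ContinuousOn B (box N)) :
    ∃ T : L2M N M →ₗ[ℂ] L2M N M,
      ∀ f, T f =ᵐ[boxMeasure N] fun k => matOp (B k) (f k) := by
  have hcomp : IsCompact (box N) := isCompact_univ_pi fun _ => isCompact_Icc
  have hcont : ContinuousOn (fun k => matOp (B k)) (box N) :=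
    continuous_matOp.comp_continuousOn hB
  obtain ⟨c, hc⟩ := hcomp.exists_bound_of_continuousOn hcont
  obtain ⟨T, hT⟩ := exists_mulOp (μ := boxMeasure N)
    (hcont.aestronglyMeasurable hcomp.measurableSet)
    ((ae_mem_box N).mono fun k hk => hc k hk)
  exact ⟨T, hT⟩

lemma memLp_comp_cons {f : (Fin (n + 1) → ℝ) → EuclideanSpace ℂ (Fin M)} {p : ENNReal}
    (hf : MemLp f p (boxMeasure (n + 1))) :
    MemLp (fun q : ℝ × (Fin n → ℝ) => f (Fin.cons q.1 q.2)) p (sideMeasure.prod (boxMeasure n)) :=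
  hf.comp_measurePreserving (measurePreserving_cons n)

lemma exists_firstAvgOp (n M : ℕ) :
    ∃ P : L2M (n + 1) M →ₗ[ℂ] L2M n M, ∀ f, P f =ᵐ[boxMeasure n] firstAvg f := by
  refine exists_linearMap_Lp firstAvg (fun f hf => ?_) (fun f g h => ?_)
    (fun f g hf hg => ?_) (fun r f _ => ?_)
  · exact (memLp_integral_left (memLp_comp_cons hf)).const_smul (((2 * Real.pi) ^ ((1 : ℝ) / 2))⁻¹)
  · filter_upwards [ae_ae_cons h] with k hk
    rw [firstAvg, firstAvg, integral_congr_ae hk]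
  · filter_upwards [((memLp_comp_cons hf).integrable one_le_two).prod_left_ae,
      ((memLp_comp_cons hg).integrable one_le_two).prod_left_ae] with k hfk hgk
    simp only [firstAvg, Pi.add_apply]
    rw [integral_add hfk hgk, smul_add]
  · refine .of_forall fun k => ?_
    simp only [firstAvg, Pi.smul_apply]
    rw [integral_smul, smul_comm]

lemma memLp_comp_tail {g : (Fin n → ℝ) → EuclideanSpace ℂ (Fin M)} {p : ENNReal}
    (hg : MemLp g p (boxMeasure n)) :
    MemLp (fun k : Fin (n + 1) → ℝ => g (Fin.tail k)) p (boxMeasure (n + 1)) :=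
  (hg.comp_snd sideMeasure).comp_measurePreserving (measurePreserving_head_tail n)

/-- The extension of `g` to a function independent of the first variable, normalized so that
averaging over the first variable gives `g` back. -/
def constExtend (g : (Fin n → ℝ) → EuclideanSpace ℂ (Fin M)) (k : Fin (n + 1) → ℝ) :
    EuclideanSpace ℂ (Fin M) :=
  ((2 * Real.pi) ^ ((1 : ℝ) / 2))⁻¹ • g (Fin.tail k)

lemma exists_constExtendOp (n M : ℕ) :
    ∃ E : L2M n M →ₗ[ℂ] L2M (n + 1) M, ∀ g, E g =ᵐ[boxMeasure (n + 1)] constExtend g := by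
  refine exists_linearMap_Lp constExtend (fun g hg => ?_) (fun f g h => ?_)
    (fun f g _ _ => ?_) (fun r f _ => ?_)
  · exact (memLp_comp_tail hg).const_smul (((2 * Real.pi) ^ ((1 : ℝ) / 2))⁻¹)
  · filter_upwards [(quasiMeasurePreserving_tail n).ae h] with k hk
    rw [constExtend, constExtend, hk]
  · exact .of_forall fun k => by simp [constExtend]
  · exact .of_forall fun k => by simp [constExtend, smul_comm r]

lemma firstAvg_congr_constExtend {f : (Fin (n + 1) → ℝ) → EuclideanSpace ℂ (Fin M)}
    {g : (Fin n → ℝ) → EuclideanSpace ℂ (Fin M)} (h : f =ᵐ[boxMeasure (n + 1)] constExtend g) :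
    firstAvg f =ᵐ[boxMeasure n] g := by
  filter_upwards [ae_ae_cons h] with k hk
  rw [firstAvg, integral_congr_ae hk]
  simp only [constExtend, Fin.tail_cons, integral_const, smul_smul, Measure.real,
    sideMeasure_univ, ENNReal.toReal_ofReal Real.two_pi_pos.le]
  convert one_smul ℝ (g k)
  rw [← Real.sqrt_eq_rpow]
  have := Real.sqrt_pos.2 Real.two_pi_pos
  field_simp
  exact (Real.sq_sqrt Real.two_pi_pos.le).symm

lemma bijective_id_add_comp_swap {R V W : Type*} [Ring R] [AddCommGroup V] [Module R V]
    [AddCommGroup W] [Module R W] {Y : W →ₗ[R] V} {P : V →ₗ[R] W}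
    (h : Function.Bijective (LinearMap.id + Y ∘ₗ P : V →ₗ[R] V)) :
    Function.Bijective (LinearMap.id + P ∘ₗ Y : W →ₗ[R] W) := by
  refine ⟨(injective_iff_map_eq_zero _).2 fun w hw => ?_, fun w => ?_⟩
  · simp only [LinearMap.add_apply, LinearMap.id_apply, LinearMap.comp_apply] at hw
    have hY : Y w = 0 := (injective_iff_map_eq_zero _).1 h.1 _ (by simp [← map_add, hw])
    simpa [hY] using hw
  · obtain ⟨v, hv⟩ := h.2 (Y w)
    refine ⟨w - P v, ?_⟩
    simp only [LinearMap.add_apply, LinearMap.id_apply, LinearMap.comp_apply] at hv ⊢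
    rw [map_sub, ← hv]
    simp

lemma bijective_id_add_comp_iff {R V W : Type*} [Ring R] [AddCommGroup V] [Module R V]
    [AddCommGroup W] [Module R W] (Y : W →ₗ[R] V) (P : V →ₗ[R] W) :
    Function.Bijective (LinearMap.id + Y ∘ₗ P : V →ₗ[R] V) ↔
      Function.Bijective (LinearMap.id + P ∘ₗ Y : W →ₗ[R] W) :=
  ⟨bijective_id_add_comp_swap, bijective_id_add_comp_swap⟩

lemma integral_matOp_sum_apply {ι : Type*} (s : Finset ι)
    {G : ι → ℝ → Matrix (Fin M) (Fin M) ℂ}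
    (hG : ∀ j ∈ s, ContinuousOn (G j) (Set.Icc (-Real.pi) Real.pi))
    (v : ι → EuclideanSpace ℂ (Fin M)) (c : ℝ) (a : Fin M) :
    (c • ∫ t, ∑ j ∈ s, matOp (G j t) (v j) ∂sideMeasure) a =
      ∑ j ∈ s, ∑ b, ((c : ℂ) * ∫ t, G j t a b ∂sideMeasure) * v j b := by
  have hint : ∀ j ∈ s, Integrable (fun t => matOp (G j t) (v j)) sideMeasure := fun j hj =>
    ((continuous_matOp.comp_continuousOn (hG j hj)).clm_apply continuousOn_const).integrableOn_Icc
  rw [integral_finsetSum _ hint, PiLp.smul_apply, WithLp.ofLp_sum, Finset.sum_apply,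
    Complex.real_smul, Finset.mul_sum]
  refine Finset.sum_congr rfl fun j hj => ?_
  rw [integral_matOp_apply (hG j hj), Finset.mul_sum]
  simp only [mul_assoc]

/-- If `T f = B f + K (P f)` with `B` invertible, then `T` is
bijective exactly when `1 + P B⁻¹ K` is. -/
lemma bijective_add_comp_iff {R V W : Type*} [Ring R] [AddCommGroup V] [Module R V]
    [AddCommGroup W] [Module R W] {T B B' : V →ₗ[R] V} {K : W →ₗ[R] V} {P : V →ₗ[R] W}
    {C : W →ₗ[R] W} (hl : ∀ f, B' (B f) = f) (hr : ∀ f, B (B' f) = f)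
    (hT : ∀ f, T f = B f + K (P f)) (hC : ∀ g, C g = g + P (B' (K g))) :
    Function.Bijective T ↔ Function.Bijective C := by
  have hB : Function.Bijective B := Function.bijective_iff_has_inverse.2 ⟨B', hl, hr⟩
  have hT' : (T : V → V) = B ∘ (LinearMap.id + (B' ∘ₗ K) ∘ₗ P : V →ₗ[R] V) := by
    funext f
    simp [hT, hr]
  have hC' : C = LinearMap.id + P ∘ₗ (B' ∘ₗ K) := by
    ext g
    simp [hC]
  rw [hT', hB.of_comp_iff', bijective_id_add_comp_iff, hC']

end

/-- STATEMENT 12 (dimension-reduction equivalence in the proof of Theorem 3.1), stated with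
`N = n+1 ≥ 2`: if `B₀ = A − λI` has everywhere nonvanishing determinant on `[-π,π]^{n+1}`,
then, with `B₁ = I + ⟨B₀⁻¹A₁⟩₁` and the reduced operator
`Ĉ₁ ĝ = B₁ ĝ + Σ_{j=2}^{n+1} ⟨B₀⁻¹A_j⟩₁ ⟨ĝ⟩_{2…j}` acting on `L²_M([-π,π]^n)`
(functions of `(k₂,…,k_{n+1})`), the operator `Ĉ − λ` is a bijection of `L²_M` iff `Ĉ₁`
is a bijection of `L²_M([-π,π]^n)`; equivalently `0 ∈ spec(Ĉ−λ) ↔ 0 ∈ spec(Ĉ₁)`.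
(`⟨·⟩₁` and matrix inversion are taken entrywise resp. pointwise in `k`.) -/
theorem dimension_reduction_equivalence (n M : ℕ) (hn : 1 ≤ n) (hM : 0 < M)
    (A : (Fin (n+1) → ℝ) → Matrix (Fin M) (Fin M) ℂ)
    (AA : ℕ → (Fin (n+1) → ℝ) → Matrix (Fin M) (Fin M) ℂ)
    (hAcont : Continuous A)
    (hAper : ∀ (k : Fin (n+1) → ℝ) (i : Fin (n+1)),
      A (Function.update k i (k i + 2 * Real.pi)) = A k)
    (hAAcont : ∀ j ∈ Finset.Icc 1 (n+1), Continuous (AA j))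
    (hAAper : ∀ j ∈ Finset.Icc 1 (n+1), ∀ (k : Fin (n+1) → ℝ) (i : Fin (n+1)),
      AA j (Function.update k i (k i + 2 * Real.pi)) = AA j k)
    (hAAindep : ∀ j ∈ Finset.Icc 1 (n+1), ∀ k k' : Fin (n+1) → ℝ,
      (∀ i : Fin (n+1), j ≤ (i : ℕ) → k i = k' i) → AA j k = AA j k')
    (Chat : L2M (n+1) M →L[ℂ] L2M (n+1) M)
    (hChat : ∀ f : L2M (n+1) M, ∀ᵐ k ∂(boxMeasure (n+1)), ∀ a : Fin M,
      (Chat f) k a = (∑ b : Fin M, A k a b * f k b) +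
        ∑ j ∈ Finset.Icc 1 (n+1), ∑ b : Fin M, AA j k a b * navg j (⇑f) k b)
    (lam : ℂ)
    (hdet : ∀ k ∈ box (n+1),
      (A k - lam • (1 : Matrix (Fin M) (Fin M) ℂ)).det ≠ 0)
    (C1 : L2M n M →L[ℂ] L2M n M)
    (hC1 : ∀ g : L2M n M, ∀ᵐ k' ∂(boxMeasure n), ∀ a : Fin M,
      (C1 g) k' a =
        (∑ b : Fin M,
          ((1 : Matrix (Fin M) (Fin M) ℂ) a b +
            ((2 * Real.pi) ^ ((1 : ℝ) / 2))⁻¹ *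
              ∫ t in Set.Icc (-Real.pi) Real.pi,
                ((A (Fin.cons t k') - lam • (1 : Matrix (Fin M) (Fin M) ℂ))⁻¹
                  * AA 1 (Fin.cons t k')) a b) * g k' b) +
        ∑ j ∈ Finset.Icc 2 (n+1), ∑ b : Fin M,
          (((2 * Real.pi) ^ ((1 : ℝ) / 2))⁻¹ *
            ∫ t in Set.Icc (-Real.pi) Real.pi,
              ((A (Fin.cons t k') - lam • (1 : Matrix (Fin M) (Fin M) ℂ))⁻¹
                * AA j (Fin.cons t k')) a b) * navg (j-1) (⇑g) k' b) :
    Function.Bijective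
        ⇑(Chat - lam • ContinuousLinearMap.id ℂ (L2M (n+1) M)) ↔
      Function.Bijective ⇑C1 := by
  set B : (Fin (n + 1) → ℝ) → Matrix (Fin M) (Fin M) ℂ :=
    fun k => A k - lam • (1 : Matrix (Fin M) (Fin M) ℂ) with hBdef
  have hBcont : Continuous B := hAcont.sub continuous_const
  have hBinv : ContinuousOn (fun k => (B k)⁻¹) (box (n + 1)) := continuousOn_matrix_inv hBcont hdet
  obtain ⟨S, hS⟩ := exists_matrixMulOp hBcont.continuousOn
  obtain ⟨S', hS'⟩ := exists_matrixMulOp hBinv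
  obtain ⟨P, hP⟩ := exists_firstAvgOp n M
  obtain ⟨E, hE⟩ := exists_constExtendOp n M
  set T := Chat - lam • ContinuousLinearMap.id ℂ (L2M (n + 1) M) with hTdef
  have hPE : ∀ g, P (E g) = g := fun g =>
    Lp.ext ((hP (E g)).trans (firstAvg_congr_constExtend (hE g)))
  have hT : ∀ f, ∀ᵐ k ∂boxMeasure (n + 1), T f k =
      S f k + ∑ j ∈ Finset.Icc 1 (n + 1), matOp (AA j k) (navg (j - 1) (P f) (Fin.tail k)) := by
    intro f
    have hnavg : ∀ j ∈ Finset.Icc 1 (n + 1), ∀ᵐ k ∂boxMeasure (n + 1),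
        navg j f k = navg (j - 1) (P f) (Fin.tail k) := by
      intro j hj
      obtain ⟨i, rfl⟩ := Nat.exists_eq_add_of_le' (Finset.mem_Icc.1 hj).1
      have hi : i ≤ n := Nat.le_of_succ_le_succ (Finset.mem_Icc.1 hj).2
      filter_upwards [ae_navg_succ hi ((Lp.memLp f).integrable one_le_two),
        (quasiMeasurePreserving_tail n).ae (ae_navg_congr hi (hP f))] with k h1 h2
      rw [h1, Nat.add_sub_cancel, h2]
    filter_upwards [hChat f, hS f, Lp.coeFn_sub (Chat f) (lam • f), Lp.coeFn_smul lam f,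
      (Finset.eventually_all _).2 hnavg] with k hC hSk hsub hsmul hn
    have hTk : T f k = Chat f k - lam • f k := by
      rw [← Pi.smul_apply, ← hsmul]
      exact hsub
    rw [hTk, hSk, ← Finset.sum_congr rfl fun j hj => congrArg (matOp (AA j k)) (hn j hj)]
    ext a
    simp only [PiLp.sub_apply, PiLp.smul_apply, PiLp.add_apply, WithLp.ofLp_sum, Finset.sum_apply,
      matOp_apply, hC, hBdef, Matrix.sub_apply, Matrix.smul_apply, sub_mul, Finset.sum_sub_distrib]
    simp [Matrix.one_apply]
    ring
  let K : L2M n M →ₗ[ℂ] L2M (n + 1) M := ((T : L2M (n + 1) M →ₗ[ℂ] L2M (n + 1) M) - S) ∘ₗ E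
  have hK : ∀ g, ∀ᵐ k ∂boxMeasure (n + 1), K g k =
      ∑ j ∈ Finset.Icc 1 (n + 1), matOp (AA j k) (navg (j - 1) g (Fin.tail k)) := by
    intro g
    filter_upwards [hT (E g), Lp.coeFn_sub (T (E g)) (S (E g))] with k hk hsub
    rw [hPE] at hk
    have hKk : K g k = T (E g) k - S (E g) k := hsub
    rw [hKk, hk, add_sub_cancel_left]
  have hdet' : ∀ᵐ k ∂boxMeasure (n + 1), IsUnit (B k).det :=
    (ae_mem_box (n + 1)).mono fun k hk => (hdet k hk).isUnit
  refine bijective_add_comp_iff (T := (T : L2M (n + 1) M →ₗ[ℂ] L2M (n + 1) M)) (B := S) (B' := S')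
    (K := K) (P := P) (C := (C1 : L2M n M →ₗ[ℂ] L2M n M)) (fun f => Lp.ext ?_)
    (fun f => Lp.ext ?_) (fun f => Lp.ext ?_) (fun g => Lp.ext ?_)
  · filter_upwards [hS' (S f), hS f, hdet'] with k h1 h2 h3
    rw [h1, h2, ← matOp_mul_apply, Matrix.nonsing_inv_mul _ h3, map_one]
    rfl
  · filter_upwards [hS (S' f), hS' f, hdet'] with k h1 h2 h3
    rw [h1, h2, ← matOp_mul_apply, Matrix.mul_nonsing_inv _ h3, map_one]
    rfl
  · filter_upwards [hT f, hK (P f), Lp.coeFn_add (S f) (K (P f))] with k h1 h2 h3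
    rw [h3, Pi.add_apply, h2]
    exact h1
  · have hY : ∀ᵐ k ∂boxMeasure (n + 1), S' (K g) k = ∑ j ∈ Finset.Icc 1 (n + 1),
        matOp ((B k)⁻¹ * AA j k) (navg (j - 1) g (Fin.tail k)) := by
      filter_upwards [hS' (K g), hK g] with k h1 h2
      rw [h1, h2, map_sum]
      simp only [matOp_mul_apply]
    filter_upwards [hC1 g, Lp.coeFn_add g (P (S' (K g))), hP (S' (K g)), ae_ae_cons hY,
      ae_mem_box n] with k h1 h2 h3 h4 hk
    rw [h2, Pi.add_apply, h3, firstAvg, integral_congr_ae h4]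
    have hcons : ContinuousOn (fun t : ℝ => (Fin.cons t k : Fin (n + 1) → ℝ))
        (Set.Icc (-Real.pi) Real.pi) :=
      (Continuous.finCons (A := fun _ => ℝ) continuous_id continuous_const).continuousOn
    have hmaps : Set.MapsTo (fun t : ℝ => (Fin.cons t k : Fin (n + 1) → ℝ))
        (Set.Icc (-Real.pi) Real.pi) (box (n + 1)) := by
      intro t ht i _
      exact Fin.cases ht (fun i => hk i trivial) i
    have hG : ∀ j ∈ Finset.Icc 1 (n + 1), ContinuousOn
        (fun t : ℝ => (B (Fin.cons t k))⁻¹ * AA j (Fin.cons t k)) (Set.Icc (-Real.pi) Real.pi) :=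
      fun j hj => (hBinv.comp hcons hmaps).mul ((hAAcont j hj).comp_continuousOn hcons)
    ext a
    have hIcc : Finset.Icc 1 (n + 1) = insert 1 (Finset.Icc 2 (n + 1)) := by
      ext j
      simp only [Finset.mem_Icc, Finset.mem_insert]
      omega
    simp only [Fin.tail_cons]
    rw [PiLp.add_apply, integral_matOp_sum_apply _ hG, hIcc, Finset.sum_insert (by simp)]
    refine (h1 a).trans ?_
    simp only [add_mul, Finset.sum_add_distrib, Nat.sub_self, navg_zero, add_assoc]
    simp [Matrix.one_apply]
    rfl
end
end
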